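/- Fix a finite-horizon MDP with transition functions p_t, a risk level α > 0, and an initial state s_0 ∈ S. Then there exists a deterministic Markov policy π* = (π*_t)_{t=0}^{T−1}, π*_t : S → A, such that for every history-dependent randomized policy σ, ERM^α[ Σ_{t=0}^{T−1} γ^t·r(S_t, A_t) under π* from s_0 ] ≥ ERM^α[ Σ_{t=0}^{T−1} γ^t·r(S_t, A_t) under σ from s_0 ]. In particular, a policy that is greedy with respect to the optimal value functions v*_t (i.e., π*_t(s) attains max_{a∈A} -(1/(α·γ^t))·log( Σ_{s'} p_t(s'|s,a)·exp(−α·γ^t·(r(s,a) + γ·v*_{t+1}(s'))) )) is such an optimal policy. -/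

import Mathlib

open Finset

noncomputable section

/-- The state occupied at step `i` of a trajectory that starts in state `s`, where
`w j = (action taken at step j, state reached after step j)`. -/
def stAt {S A : Type*} {n : ℕ} (s : S) (w : Fin n → A × S) (i : Fin n) : S :=
  if _ : i.1 = 0 then s else (w ⟨i.1 - 1, Nat.lt_of_le_of_lt (Nat.sub_le i.1 1) i.2⟩).2

/-- The `γ`-discounted return `∑_i γ^i · r(S_i, A_i)` of the trajectory `w` started in `s`. -/
def trajRet {S A : Type*} (r : S → A → ℝ) (γ : ℝ) {n : ℕ} (s : S) (w : Fin n → A × S) : ℝ :=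
  ∑ i : Fin n, γ ^ i.1 * r (stAt s w i) (w i).1

/-- Probability of the trajectory `w` started at time `0` in state `s0` under the
history-dependent randomized policy `σ` (which sees the time, the list of past
(state, action) pairs, and the current state) and the transitions `p`. -/
def histProb {S A : Type*} [Fintype S] [Fintype A] (σ : ℕ → List (S × A) → S → A → ℝ)
    (p : ℕ → S → A → S → ℝ) {n : ℕ} (s0 : S) (w : Fin n → A × S) : ℝ :=
  ∏ i : Fin n,
    σ i.1 (List.ofFn fun j : Fin i.1 =>
        (stAt s0 w ⟨j.1, j.2.trans i.2⟩, (w ⟨j.1, j.2.trans i.2⟩).1))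
      (stAt s0 w i) (w i).1 *
      p i.1 (stAt s0 w i) (w i).1 (w i).2

/-- Probability of the trajectory `w` started at time `0` in state `s0` under the
deterministic Markov policy `π` and the transitions `p`. -/
def detProb {S A : Type*} [Fintype S] [Fintype A] [DecidableEq A] (π : ℕ → S → A)
    (p : ℕ → S → A → S → ℝ) {n : ℕ} (s0 : S) (w : Fin n → A × S) : ℝ :=
  ∏ i : Fin n,
    (if (w i).1 = π i.1 (stAt s0 w i) then (1 : ℝ) else 0) *
      p i.1 (stAt s0 w i) (w i).1 (w i).2

/-- `ERM^α` of the `T`-step discounted return from `s0` under a history-dependent policy. -/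
def ermHist {S A : Type*} [Fintype S] [Fintype A] (σ : ℕ → List (S × A) → S → A → ℝ)
    (p : ℕ → S → A → S → ℝ) (r : S → A → ℝ) (γ α : ℝ) (T : ℕ) (s0 : S) : ℝ :=
  -(1 / α) * Real.log
    (∑ w : Fin T → A × S, histProb σ p s0 w * Real.exp (-α * trajRet r γ s0 w))

/-- `ERM^α` of the `T`-step discounted return from `s0` under a deterministic Markov policy. -/
def ermDet {S A : Type*} [Fintype S] [Fintype A] [DecidableEq A] (π : ℕ → S → A)
    (p : ℕ → S → A → S → ℝ) (r : S → A → ℝ) (γ α : ℝ) (T : ℕ) (s0 : S) : ℝ :=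
  -(1 / α) * Real.log
    (∑ w : Fin T → A × S, detProb π p s0 w * Real.exp (-α * trajRet r γ s0 w))

/-- Optimal value functions by backward recursion on the number `n` of remaining steps:
`vstarAux p r γ α 0 t = 0` and
`vstarAux p r γ α (n+1) t s =
  max_a -(1/(αγ^t)) log ( ∑_{s'} p_t(s'|s,a) exp(-αγ^t (r(s,a) + γ · vstarAux n (t+1) s')) )`.
The optimal value at time `t` in a horizon-`T` problem is `vstarAux p r γ α (T - t) t`. -/
def vstarAux {S A : Type*} [Fintype S] [Fintype A] [Nonempty A] (p : ℕ → S → A → S → ℝ)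
    (r : S → A → ℝ) (γ α : ℝ) : ℕ → ℕ → S → ℝ
  | 0, _, _ => 0
  | n + 1, t, s =>
    Finset.univ.sup' Finset.univ_nonempty fun a : A =>
      -(1 / (α * γ ^ t)) * Real.log (∑ s' : S,
        p t s a s' * Real.exp (-(α * γ ^ t) * (r s a + γ * vstarAux p r γ α n (t + 1) s')))

/-- The Bellman optimality objective at time `t`, state `s`, action `a` for horizon `T`. -/
def bell {S A : Type*} [Fintype S] [Fintype A] [Nonempty A] (p : ℕ → S → A → S → ℝ)
    (r : S → A → ℝ) (γ α : ℝ) (T t : ℕ) (s : S) (a : A) : ℝ :=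
  -(1 / (α * γ ^ t)) * Real.log (∑ s' : S,
    p t s a s' * Real.exp (-(α * γ ^ t) * (r s a + γ * vstarAux p r γ α (T - (t + 1)) (t + 1) s')))

/-- `σ` is a history-dependent randomized policy: every conditional is in `Δ(A)`. -/
def IsHistPolicy {S A : Type*} [Fintype A] (σ : ℕ → List (S × A) → S → A → ℝ) : Prop :=
  ∀ t h s, (∀ a, 0 ≤ σ t h s a) ∧ ∑ a, σ t h s a = 1

theorem stAt_cons_zero {S A : Type*} {n : ℕ} (s : S) (x : A × S) (w : Fin n → A × S)
    (h : 0 < n + 1) :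
    stAt s (Fin.cons x w : Fin (n + 1) → A × S) ⟨0, h⟩ = s := by
  simp [stAt]

theorem stAt_cons_succ {S A : Type*} {n : ℕ} (s : S) (x : A × S) (w : Fin n → A × S)
    (i : ℕ) (hi : i + 1 < n + 1) :
    stAt s (Fin.cons x w : Fin (n + 1) → A × S) ⟨i + 1, hi⟩
      = stAt x.2 w ⟨i, Nat.lt_of_succ_lt_succ hi⟩ := by
  cases i with
  | zero =>
    simp only [stAt]
    simp
  | succ k =>
    simp only [stAt]
    simp only [Nat.add_sub_cancel, Nat.add_eq_zero_iff, one_ne_zero, and_false, dite_false]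
    rw [← Fin.succ_mk n k (by omega), Fin.cons_succ]

theorem cons_mk_succ {B : Type*} {n : ℕ} (x : B) (w : Fin n → B) (i : ℕ) (hi : i + 1 < n + 1) :
    (Fin.cons x w : Fin (n + 1) → B) ⟨i + 1, hi⟩ = w ⟨i, Nat.lt_of_succ_lt_succ hi⟩ := by
  rw [← Fin.succ_mk n i (by omega), Fin.cons_succ]

theorem trajRet_cons {S A : Type*} (r : S → A → ℝ) (γ : ℝ) {n : ℕ} (s : S) (x : A × S)
    (w : Fin n → A × S) :
    trajRet r γ s (Fin.cons x w : Fin (n + 1) → A × S) = r s x.1 + γ * trajRet r γ x.2 w := by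
  unfold trajRet
  rw [Fin.sum_univ_succ, Finset.mul_sum]
  congr 1
  · have := stAt_cons_zero s x w (Nat.succ_pos n)
    simp [stAt]
  · refine Finset.sum_congr rfl fun i _ => ?_
    have := stAt_cons_succ s x w i.1 i.succ.2
    rw [show i.succ = ⟨i.1 + 1, i.succ.2⟩ from rfl, this, cons_mk_succ]
    simp only [pow_succ]
    ring

theorem histProb_cons {S A : Type*} [Fintype S] [Fintype A]
    (σ : ℕ → List (S × A) → S → A → ℝ)
    (p : ℕ → S → A → S → ℝ) {n : ℕ} (s : S) (x : A × S) (w : Fin n → A × S) :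
    histProb σ p s (Fin.cons x w : Fin (n + 1) → A × S)
      = (σ 0 [] s x.1 * p 0 s x.1 x.2) *
        histProb (fun t h => σ (t + 1) ((s, x.1) :: h)) (fun t => p (t + 1)) x.2 w := by
  unfold histProb
  rw [Fin.prod_univ_succ]
  congr 1
  · refine Finset.prod_congr rfl fun i _ => ?_
    have := stAt_cons_succ s x w i.1 i.succ.2
    rw [show i.succ = ⟨i.1 + 1, i.succ.2⟩ from rfl, this, cons_mk_succ]
    simp only
    rw [List.ofFn_succ]
    congr 3
    simp only [Fin.val_succ, stAt_cons_succ, cons_mk_succ]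

/-- The exponential moment of the return. -/
def Zh {S A : Type*} [Fintype S] [Fintype A] (σ : ℕ → List (S × A) → S → A → ℝ)
    (p : ℕ → S → A → S → ℝ) (r : S → A → ℝ) (γ α : ℝ) (T : ℕ) (s0 : S) : ℝ :=
  ∑ w : Fin T → A × S, histProb σ p s0 w * Real.exp (-α * trajRet r γ s0 w)

theorem Zh_succ {S A : Type*} [Fintype S] [Fintype A] (σ : ℕ → List (S × A) → S → A → ℝ)
    (p : ℕ → S → A → S → ℝ) (r : S → A → ℝ) (γ α : ℝ) (n : ℕ) (s : S) :
    Zh σ p r γ α (n + 1) s = ∑ a, σ 0 [] s a * ∑ s', p 0 s a s' * (Real.exp (-α * r s a) *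
      Zh (fun t h => σ (t + 1) ((s, a) :: h)) (fun t => p (t + 1)) r γ (α * γ) n s') := by
  unfold Zh
  rw [← (Fin.consEquiv (fun _ : Fin (n + 1) => A × S)).sum_comp, Fintype.sum_prod_type,
    Fintype.sum_prod_type]
  refine Finset.sum_congr rfl fun a _ => ?_
  rw [Finset.mul_sum]
  refine Finset.sum_congr rfl fun s' _ => ?_
  rw [Finset.mul_sum, Finset.mul_sum, Finset.mul_sum]
  refine Finset.sum_congr rfl fun w _ => ?_
  have h1 := histProb_cons σ p s (a, s') w
  have h2 := trajRet_cons r γ s (a, s') w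
  simp only [Fin.consEquiv, Equiv.coe_fn_mk]
  rw [h1, h2, show -α * (r s (a, s').1 + γ * trajRet r γ (a, s').2 w)
    = -α * r s a + -(α * γ) * trajRet r γ s' w by simp only; ring, Real.exp_add]
  ring

theorem vstarAux_shift {S A : Type*} [Fintype S] [Fintype A] [Nonempty A]
    (p : ℕ → S → A → S → ℝ) (r : S → A → ℝ) (γ α : ℝ) (n : ℕ) :
    ∀ t s, vstarAux p r γ α n (t + 1) s = vstarAux (fun t => p (t + 1)) r γ (α * γ) n t s := by
  induction n with
  | zero => intro t s; rfl
  | succ n ih =>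
    intro t s
    simp only [vstarAux, ih, pow_succ', mul_assoc]

theorem bell_shift {S A : Type*} [Fintype S] [Fintype A] [Nonempty A]
    (p : ℕ → S → A → S → ℝ) (r : S → A → ℝ) (γ α : ℝ) (T t : ℕ) (s : S) (a : A) :
    bell p r γ α (T + 1) (t + 1) s a = bell (fun t => p (t + 1)) r γ (α * γ) T t s a := by
  simp only [bell, vstarAux_shift, pow_succ', mul_assoc, Nat.add_sub_add_right]

theorem exp_bell {S A : Type*} [Fintype S] [Fintype A] [Nonempty A]
    (p : ℕ → S → A → S → ℝ) (r : S → A → ℝ) (γ α : ℝ) (hα : 0 < α) (n : ℕ) (s : S) (a : A)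
    (hp : (∀ s', 0 ≤ p 0 s a s') ∧ ∑ s', p 0 s a s' = 1) :
    Real.exp (-α * bell p r γ α (n + 1) 0 s a) = ∑ s', p 0 s a s' * (Real.exp (-α * r s a) *
      Real.exp (-(α * γ) * vstarAux (fun t => p (t + 1)) r γ (α * γ) n 0 s')) := by
  have hX : 0 < ∑ s', p 0 s a s' * (Real.exp (-α * r s a) *
      Real.exp (-(α * γ) * vstarAux (fun t => p (t + 1)) r γ (α * γ) n 0 s')) := by
    obtain ⟨s1, -, h1⟩ : ∃ s' ∈ Finset.univ, 0 < p 0 s a s' := by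
      by_contra! h
      have := Finset.sum_nonpos h
      linarith [hp.2]
    refine Finset.sum_pos' (fun s' _ => mul_nonneg (hp.1 s') (by positivity))
      ⟨s1, Finset.mem_univ _, by positivity⟩
  have : bell p r γ α (n + 1) 0 s a = -(1 / α) * Real.log (∑ s', p 0 s a s' *
      (Real.exp (-α * r s a) *
      Real.exp (-(α * γ) * vstarAux (fun t => p (t + 1)) r γ (α * γ) n 0 s'))) := by
    simp only [bell, vstarAux_shift, pow_zero, mul_one, Nat.add_sub_add_right, Nat.sub_zero]
    congr 2
    refine Finset.sum_congr rfl fun s' _ => ?_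
    rw [← Real.exp_add]
    congr 2
    ring
  rw [this, ← mul_assoc, show -α * -(1 / α) = 1 by field_simp, one_mul, Real.exp_log hX]

theorem vstar_eq_sup {S A : Type*} [Fintype S] [Fintype A] [Nonempty A]
    (p : ℕ → S → A → S → ℝ) (r : S → A → ℝ) (γ α : ℝ) (n : ℕ) (s : S) :
    vstarAux p r γ α (n + 1) 0 s
      = Finset.univ.sup' Finset.univ_nonempty fun a : A => bell p r γ α (n + 1) 0 s a := rfl

theorem lower {S A : Type*} [Fintype S] [Fintype A] [Nonempty A]
    (r : S → A → ℝ) (γ : ℝ) (hγ0 : 0 < γ) (n : ℕ) : ∀ (p : ℕ → S → A → S → ℝ)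
    (_ : ∀ t < n, ∀ s a, (∀ s', 0 ≤ p t s a s') ∧ ∑ s', p t s a s' = 1)
    (α : ℝ) (_ : 0 < α) (σ : ℕ → List (S × A) → S → A → ℝ) (_ : IsHistPolicy σ) (s : S),
    Real.exp (-α * vstarAux p r γ α n 0 s) ≤ Zh σ p r γ α n s := by
  induction n with
  | zero => intro p hp α hα σ hσ s; simp [vstarAux, Zh, histProb, trajRet]
  | succ n ih =>
    intro p hp α hα σ hσ s
    rw [Zh_succ]
    calc Real.exp (-α * vstarAux p r γ α (n + 1) 0 s)
        = ∑ a, σ 0 [] s a * Real.exp (-α * vstarAux p r γ α (n + 1) 0 s) := by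
          rw [← Finset.sum_mul, (hσ 0 [] s).2, one_mul]
      _ ≤ _ := by
          refine Finset.sum_le_sum fun a _ => mul_le_mul_of_nonneg_left ?_ ((hσ 0 [] s).1 a)
          have hpa := hp 0 (Nat.succ_pos n) s a
          have h1 : bell p r γ α (n + 1) 0 s a ≤ vstarAux p r γ α (n + 1) 0 s := by
            rw [vstar_eq_sup]
            exact Finset.le_sup' (fun a => bell p r γ α (n + 1) 0 s a) (Finset.mem_univ a)
          have h2 : Real.exp (-α * vstarAux p r γ α (n + 1) 0 s)
              ≤ Real.exp (-α * bell p r γ α (n + 1) 0 s a) := by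
            apply Real.exp_le_exp.mpr
            nlinarith
          refine h2.trans ?_
          rw [exp_bell p r γ α hα n s a hpa]
          refine Finset.sum_le_sum fun s' _ => mul_le_mul_of_nonneg_left
            (mul_le_mul_of_nonneg_left ?_ (Real.exp_pos _).le) (hpa.1 s')
          exact ih (fun t => p (t + 1)) (fun t ht => hp (t + 1) (by omega)) (α * γ)
            (by positivity) _ (fun t h s => hσ _ _ _) s'

theorem greedy {S A : Type*} [Fintype S] [Fintype A] [Nonempty A] [DecidableEq A]
    (r : S → A → ℝ) (γ : ℝ) (hγ0 : 0 < γ) (n : ℕ) : ∀ (p : ℕ → S → A → S → ℝ)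
    (_ : ∀ t < n, ∀ s a, (∀ s', 0 ≤ p t s a s') ∧ ∑ s', p t s a s' = 1)
    (α : ℝ) (_ : 0 < α) (π : ℕ → S → A)
    (_ : ∀ t < n, ∀ s : S, ∀ a : A, bell p r γ α n t s a ≤ bell p r γ α n t s (π t s)) (s : S),
    Zh (fun t _ s a => if a = π t s then (1 : ℝ) else 0) p r γ α n s
      = Real.exp (-α * vstarAux p r γ α n 0 s) := by
  induction n with
  | zero => intro p hp α hα π hπ s; simp [vstarAux, Zh, histProb, trajRet]
  | succ n ih =>
    intro p hp α hα π hπ s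
    have h1 : vstarAux p r γ α (n + 1) 0 s = bell p r γ α (n + 1) 0 s (π 0 s) := by
      rw [vstar_eq_sup]
      apply le_antisymm
      · exact Finset.sup'_le _ _ fun a _ => hπ 0 (Nat.succ_pos n) s a
      · exact Finset.le_sup' (fun a => bell p r γ α (n + 1) 0 s a) (Finset.mem_univ (π 0 s))
    rw [Zh_succ, h1, exp_bell p r γ α hα n s _ (hp 0 (Nat.succ_pos n) s _)]
    simp only [ite_mul, one_mul, zero_mul, Finset.sum_ite_eq', Finset.mem_univ, if_true]
    refine Finset.sum_congr rfl fun s' _ => ?_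
    rw [ih (fun t => p (t + 1)) (fun t ht => hp (t + 1) (by omega)) (α * γ)
      (by positivity) (fun t => π (t + 1)) (fun t ht s a => by
        rw [← bell_shift, ← bell_shift]
        exact hπ (t + 1) (by omega) s a) s']

/-- **Existence of a deterministic Markov optimal policy for RASR-ERM, and optimality of
greedy policies.**  In a finite-horizon MDP with transitions `p_t`, rewards `r`, discount
`γ ∈ (0,1]`, risk level `α > 0`, and initial state `s0`: (i) there is a deterministic Markov
policy `π*` whose `ERM^α` of the `T`-step discounted return from `s0` is at least that of every
history-dependent randomized policy; (ii) every policy that is greedy with respect to the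
optimal value functions `v*` (i.e. `π*_t(s)` attains
`max_a -(1/(αγ^t)) log ∑_{s'} p_t(s'|s,a) exp(-αγ^t (r(s,a)+γ v*_{t+1}(s')))`) is such an
optimal policy. -/
theorem rasr_erm_deterministic_optimal {S A : Type*} [Fintype S] [Fintype A] [Nonempty S]
    [Nonempty A] [DecidableEq A]
    (r : S → A → ℝ) (T : ℕ) (γ : ℝ) (hγ0 : 0 < γ) (hγ1 : γ ≤ 1)
    (p : ℕ → S → A → S → ℝ)
    (hp : ∀ t < T, ∀ s a, (∀ s', 0 ≤ p t s a s') ∧ ∑ s', p t s a s' = 1)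
    (α : ℝ) (hα : 0 < α) (s0 : S) :
    (∃ πs : ℕ → S → A, ∀ σ : ℕ → List (S × A) → S → A → ℝ, IsHistPolicy σ →
      ermHist σ p r γ α T s0 ≤ ermDet πs p r γ α T s0) ∧
    (∀ πs : ℕ → S → A,
      (∀ t < T, ∀ s : S, ∀ a : A, bell p r γ α T t s a ≤ bell p r γ α T t s (πs t s)) →
      ∀ σ : ℕ → List (S × A) → S → A → ℝ, IsHistPolicy σ →
        ermHist σ p r γ α T s0 ≤ ermDet πs p r γ α T s0) := by
  have main : ∀ πs : ℕ → S → A,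
      (∀ t < T, ∀ s : S, ∀ a : A, bell p r γ α T t s a ≤ bell p r γ α T t s (πs t s)) →
      ∀ σ : ℕ → List (S × A) → S → A → ℝ, IsHistPolicy σ →
        ermHist σ p r γ α T s0 ≤ ermDet πs p r γ α T s0 := by
    intro πs hπ σ hσ
    have h1 := lower r γ hγ0 T p hp α hα σ hσ s0
    have h2 := greedy r γ hγ0 T p hp α hα πs hπ s0
    have h3 : ermHist σ p r γ α T s0 = -(1 / α) * Real.log (Zh σ p r γ α T s0) := rfl
    have h4 : ermDet πs p r γ α T s0 = -(1 / α) * Real.log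
      (Zh (fun t _ s a => if a = πs t s then (1 : ℝ) else 0) p r γ α T s0) := rfl
    rw [h3, h4, h2]
    have h5 := Real.log_le_log (Real.exp_pos _) h1
    have h6 : 0 < 1 / α := by positivity
    nlinarith
  refine ⟨?_, main⟩
  have hex : ∀ t s, ∃ b, ∀ a : A, bell p r γ α T t s a ≤ bell p r γ α T t s b :=
    fun t s => Finite.exists_max (fun a => bell p r γ α T t s a)
  choose πs hπ using hex
  exact ⟨πs, main πs fun t _ s a => hπ t s a⟩

end
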